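/- Let C_1 be an [n_1,k_1] linear code and C_2 an [n_2,k_2] linear code, both over F_q, and let C_1 ⊕ C_2 = {(c_1, c_2) : c_1 ∈ C_1, c_2 ∈ C_2} ⊆ F_q^{n_1+n_2} be their direct sum. Then for every t ≥ 1, R_t(C_1 ⊕ C_2) = R_t(C_1) + R_t(C_2). -/

import Mathlib

noncomputable section

/-- The `t`-weight of a `t × n` matrix over `F`: the number of nonzero columns. -/
def twt {F : Type*} [Field F] {t n : ℕ} (v : Matrix (Fin t) (Fin n) F) : ℕ :=
  Set.ncard {j : Fin n | ∃ i : Fin t, v i j ≠ 0}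

/-- The `t`-ball of radius `r` centered at `v`. -/
def tBall {F : Type*} [Field F] {t n : ℕ} (r : ℕ) (v : Matrix (Fin t) (Fin n) F) :
    Set (Matrix (Fin t) (Fin n) F) :=
  {v' | twt (v' - v) ≤ r}

/-- The `t`-th generalized covering radius of a code `C ⊆ F^n`: the least `r` such that
the `t`-balls of radius `r` centered at the elements of `C^t` cover `F^{t×n}`. -/
def genCovRad {F : Type*} [Field F] {n : ℕ} (C : Set (Fin n → F)) (t : ℕ) : ℕ :=
  sInf {r : ℕ | ∀ v : Matrix (Fin t) (Fin n) F,
    ∃ c : Matrix (Fin t) (Fin n) F, (∀ i, c i ∈ C) ∧ v ∈ tBall r c}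

theorem twt_add {F : Type*} [Field F] {t n₁ n₂ : ℕ} (v : Matrix (Fin t) (Fin (n₁ + n₂)) F) :
    twt v = twt (fun i j => v i (Fin.castAdd n₂ j) : Matrix (Fin t) (Fin n₁) F)
      + twt (fun i j => v i (Fin.natAdd n₁ j) : Matrix (Fin t) (Fin n₂) F) := by
  classical
  unfold twt
  simp only [Set.ncard_eq_toFinset_card', Set.toFinset_ofPred, Finset.card_filter]
  rw [Fin.sum_univ_add]

theorem twt_le {F : Type*} [Field F] {t n : ℕ} (v : Matrix (Fin t) (Fin n) F) : twt v ≤ n := by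
  unfold twt
  have h := Set.ncard_le_card {j : Fin n | ∃ i : Fin t, v i j ≠ 0}
  simpa using h

theorem genCovRad_spec {F : Type*} [Field F] {n : ℕ} (C : Set (Fin n → F)) (t : ℕ)
    (hC : C.Nonempty) (v : Matrix (Fin t) (Fin n) F) :
    ∃ c : Matrix (Fin t) (Fin n) F, (∀ i, c i ∈ C) ∧ twt (v - c) ≤ genCovRad C t := by
  obtain ⟨x, hx⟩ := hC
  have hne : {r : ℕ | ∀ v : Matrix (Fin t) (Fin n) F,
    ∃ c : Matrix (Fin t) (Fin n) F, (∀ i, c i ∈ C) ∧ v ∈ tBall r c}.Nonempty :=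
    ⟨n, fun v => ⟨fun _ => x, fun _ => hx, twt_le _⟩⟩
  exact Nat.sInf_mem hne v

theorem genCovRad_le {F : Type*} [Field F] {n : ℕ} (C : Set (Fin n → F)) (t r : ℕ)
    (h : ∀ v : Matrix (Fin t) (Fin n) F,
      ∃ c : Matrix (Fin t) (Fin n) F, (∀ i, c i ∈ C) ∧ twt (v - c) ≤ r) :
    genCovRad C t ≤ r := Nat.sInf_le h

theorem genCovRad_hard {F : Type*} [Field F] {n : ℕ} (C : Set (Fin n → F)) (t : ℕ) :
    ∃ v : Matrix (Fin t) (Fin n) F, ∀ c : Matrix (Fin t) (Fin n) F, (∀ i, c i ∈ C) →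
      genCovRad C t ≤ twt (v - c) := by
  by_contra! h
  have h0 : 0 < genCovRad C t := by
    obtain ⟨c, _, hc⟩ := h 0
    omega
  have := genCovRad_le C t (genCovRad C t - 1) (fun v => by
    obtain ⟨c, hc, hlt⟩ := h v
    exact ⟨c, hc, by omega⟩)
  omega

theorem stmt17 {F : Type*} [Field F] [Fintype F] {n₁ n₂ k₁ k₂ : ℕ}
    (C₁ : Submodule F (Fin n₁ → F)) (C₂ : Submodule F (Fin n₂ → F))
    (h₁ : Module.finrank F C₁ = k₁) (h₂ : Module.finrank F C₂ = k₂)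
    {t : ℕ} (ht : 1 ≤ t) :
    genCovRad {w : Fin (n₁ + n₂) → F | ∃ c₁ ∈ C₁, ∃ c₂ ∈ C₂, w = Fin.append c₁ c₂} t
      = genCovRad (C₁ : Set (Fin n₁ → F)) t + genCovRad (C₂ : Set (Fin n₂ → F)) t := by
  clear h₁ h₂ ht
  apply le_antisymm
  · apply genCovRad_le
    intro v
    obtain ⟨a, ha, ha'⟩ := genCovRad_spec (C₁ : Set (Fin n₁ → F)) t ⟨0, C₁.zero_mem⟩
      (fun i j => v i (Fin.castAdd n₂ j))
    obtain ⟨b, hb, hb'⟩ := genCovRad_spec (C₂ : Set (Fin n₂ → F)) t ⟨0, C₂.zero_mem⟩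
      (fun i j => v i (Fin.natAdd n₁ j))
    refine ⟨fun i => Fin.append (a i) (b i), fun i => ⟨a i, ha i, b i, hb i, rfl⟩, ?_⟩
    rw [twt_add]
    refine add_le_add (le_trans (le_of_eq ?_) ha') (le_trans (le_of_eq ?_) hb')
    · congr 1
      ext i j
      change v i (Fin.castAdd n₂ j) - Fin.append (a i) (b i) (Fin.castAdd n₂ j) = v i (Fin.castAdd n₂ j) - a i j
      rw [Fin.append_left]
    · congr 1
      ext i j
      change v i (Fin.natAdd n₁ j) - Fin.append (a i) (b i) (Fin.natAdd n₁ j) = v i (Fin.natAdd n₁ j) - b i j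
      rw [Fin.append_right]
  · obtain ⟨v, hv⟩ := genCovRad_hard (C₁ : Set (Fin n₁ → F)) t
    obtain ⟨w, hw⟩ := genCovRad_hard (C₂ : Set (Fin n₂ → F)) t
    obtain ⟨c, hc, hle⟩ := genCovRad_spec
      {w : Fin (n₁ + n₂) → F | ∃ c₁ ∈ C₁, ∃ c₂ ∈ C₂, w = Fin.append c₁ c₂} t
      ⟨_, 0, C₁.zero_mem, 0, C₂.zero_mem, rfl⟩ (fun i => Fin.append (v i) (w i))
    choose a ha b hb hab using hc
    refine le_trans ?_ hle
    rw [twt_add]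
    refine add_le_add (le_trans (hv a ha) (le_of_eq ?_)) (le_trans (hw b hb) (le_of_eq ?_))
    · congr 1
      ext i j
      change v i j - a i j = Fin.append (v i) (w i) (Fin.castAdd n₂ j) - c i (Fin.castAdd n₂ j)
      rw [hab, Fin.append_left, Fin.append_left]
    · congr 1
      ext i j
      change w i j - b i j = Fin.append (v i) (w i) (Fin.natAdd n₁ j) - c i (Fin.natAdd n₁ j)
      rw [hab, Fin.append_right, Fin.append_right]
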